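/- (Lemma 2, third identity: the special exponential e^{iβφ} coincides with the general exponential at q = e^{iπν}.) For every ν ∈ ℝ, every integer n ≥ 1, and every admissible θ ∈ ℂ^n: K̃_n^{(q)}(θ) = 2i·cos(πν/2)·K̃_n^{+}(θ) for q = e^{iπν}. (Equivalently, sin(πν/2)·K̃_n^{(e^{iπν})}(θ) = i·sin(πν)·K̃_n^{+}(θ).) -/

import Mathlib

open Finset

/-- The K-function `K_n[p](θ)` from the paper (eq. (1.2)):
`K_n[p](θ) = Σ_{l ∈ {0,1}^n} (−1)^{l_1+…+l_n} Π_{i<j} (1 + (l_i − l_j)·i·sin(πν)/sinh(θ_i − θ_j)) · p(θ,l)`. -/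
noncomputable def Kfun (ν : ℝ) {n : ℕ} (p : (Fin n → ℂ) → (Fin n → Fin 2) → ℂ)
    (θ : Fin n → ℂ) : ℂ :=
  ∑ l : Fin n → Fin 2,
    (-1 : ℂ) ^ (∑ i, (l i : ℕ)) *
    (∏ i : Fin n, ∏ j : Fin n,
      if (i : ℕ) < (j : ℕ) then
        1 + (((l i : ℕ) : ℂ) - ((l j : ℕ) : ℂ)) * Complex.I *
          (Real.sin (Real.pi * ν) : ℂ) / Complex.sinh (θ i - θ j)
      else 1) *
    p θ l

/-- `θ` is admissible if `sinh(θ_i − θ_j) ≠ 0` for all `i < j`. -/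
def Admissible {n : ℕ} (θ : Fin n → ℂ) : Prop :=
  ∀ i j : Fin n, i < j → Complex.sinh (θ i - θ j) ≠ 0

/-- p-function of the exponential operator: `p^{(q)}(θ,l) = Π_i q^{(−1)^{l_i}}`. -/
noncomputable def pq (q : ℂ) {n : ℕ} : (Fin n → ℂ) → (Fin n → Fin 2) → ℂ :=
  fun _ l => ∏ i, q ^ ((-1 : ℤ) ^ (l i : ℕ))

/-- p-function of the special exponentials `e^{±iβφ}` (ε = ±1):
`p^{±}(θ,l) = (Σ_i e^{∓θ_i}) · (Σ_i e^{±(θ_i − (iπ/2)(1 − (−1)^{l_i} ν))})`. -/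
noncomputable def pPM (ν : ℝ) (ε : ℂ) {n : ℕ} : (Fin n → ℂ) → (Fin n → Fin 2) → ℂ :=
  fun θ l => (∑ i, Complex.exp (-ε * θ i)) *
    (∑ i, Complex.exp (ε * (θ i -
      (Real.pi : ℂ) * Complex.I / 2 * (1 - (-1 : ℂ) ^ (l i : ℕ) * (ν : ℂ)))))

/-- The two-body factor `1 - a y z / (z² - y²)`; for `z = e^θ`, `y = e^φ` it equals
`1 - (a / 2) / sinh (θ - φ)`. -/
noncomputable def twoBody (a z y : ℂ) : ℂ := 1 - a * y * z / (z ^ 2 - y ^ 2)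

/-- The weight of the configuration with `l = 0` on `A` and `l = 1` on `S \ A`. -/
noncomputable def weight {ι : Type*} [DecidableEq ι] (a : ℂ) (x : ι → ℂ) (S A : Finset ι) : ℂ :=
  (-1) ^ #(S \ A) * ∏ i ∈ A, ∏ j ∈ S \ A, twoBody a (x i) (x j)

/-- The weighted sum of `p` over the subsets of `S`. -/
noncomputable def weightedSum {ι : Type*} [DecidableEq ι] (a : ℂ) (x : ι → ℂ) (S : Finset ι)
    (p : Finset ι → ℂ) : ℂ :=
  ∑ A ∈ S.powerset, weight a x S A * p A

/-- The sum of `x` over `S`, counted positively on `A` and negatively on `S \ A`. -/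
noncomputable def signedSum {ι : Type*} [DecidableEq ι] (x : ι → ℂ) (S A : Finset ι) : ℂ :=
  ∑ i ∈ A, x i - ∑ i ∈ S \ A, x i

/-- `q ^ (#A - #(S \ A))`. -/
noncomputable def signedPow {ι : Type*} [DecidableEq ι] (q : ℂ) (S A : Finset ι) : ℂ :=
  q ^ #A * q⁻¹ ^ #(S \ A)

lemma twoBody_neg_right (a z y : ℂ) : twoBody a z (-y) = twoBody a y z := by
  unfold twoBody
  rw [← neg_sub (z ^ 2) (y ^ 2), div_neg]
  ring_nf

lemma twoBody_neg_left (a z y : ℂ) : twoBody a (-z) y = twoBody a z (-y) := by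
  unfold twoBody
  ring_nf

lemma twoBody_eq_partialFractions {a z y : ℂ} (h : z ^ 2 ≠ y ^ 2) :
    twoBody a z y = 1 - a / 2 * y * (1 / (z - y) + 1 / (z + y)) := by
  have h1 : z - y ≠ 0 := fun h0 => h (by linear_combination (z + y) * h0)
  have h2 : z + y ≠ 0 := fun h0 => h (by linear_combination (z - y) * h0)
  have h3 : z ^ 2 - y ^ 2 ≠ 0 := sub_ne_zero.mpr h
  unfold twoBody
  rw [show z ^ 2 - y ^ 2 = (z - y) * (z + y) by ring]
  field_simp
  ring

lemma twoBody_div_sub {a z y u : ℂ} (hzy : z ^ 2 ≠ y ^ 2) (huy : u ^ 2 ≠ y ^ 2) (hzu : z ≠ u) :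
    twoBody a z y / (z - u) = twoBody a u y / (z - u)
      - a / 2 * y * (1 / ((y - u) * (z - y)) + 1 / ((-y - u) * (z + y))) := by
  rw [twoBody_eq_partialFractions hzy, twoBody_eq_partialFractions huy]
  have h1 : z - y ≠ 0 := fun h0 => hzy (by linear_combination (z + y) * h0)
  have h2 : z + y ≠ 0 := fun h0 => hzy (by linear_combination (z - y) * h0)
  have h3 : u - y ≠ 0 := fun h0 => huy (by linear_combination (u + y) * h0)
  have h4 : u + y ≠ 0 := fun h0 => huy (by linear_combination (u - y) * h0)
  have h5 : z - u ≠ 0 := sub_ne_zero.mpr hzu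
  rw [show y - u = -(u - y) by ring, show -y - u = -(u + y) by ring]
  field_simp
  ring

section PartialFractions

variable {ι : Type*} [DecidableEq ι]

/-- Partial fraction decomposition of a product of two-body factors in `z`. -/
lemma prod_twoBody_eq_partialFractions (a : ℂ) (y : ι → ℂ) (B : Finset ι)
    (hy : Set.InjOn (fun i => y i ^ 2) B) (z : ℂ) (hz : ∀ i ∈ B, z ^ 2 ≠ y i ^ 2) :
    ∏ i ∈ B, twoBody a z (y i) = 1 - a / 2 * ∑ j ∈ B, y j *
      ((∏ i ∈ B.erase j, twoBody a (y j) (y i)) * (1 / (z - y j)) +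
        (∏ i ∈ B.erase j, twoBody a (-y j) (y i)) * (1 / (z + y j))) := by
  induction B using Finset.induction_on generalizing z with
  | empty => simp
  | insert k B hk ih =>
    have hyB : Set.InjOn (fun i => y i ^ 2) B := hy.mono (by simp)
    have hne : ∀ i ∈ B, y k ^ 2 ≠ y i ^ 2 := fun i hi h =>
      hk (hy (by simp) (by simp [hi]) h ▸ hi)
    have hzk := hz k (by simp)
    have hsum : ∑ j ∈ B, y j *
        ((∏ i ∈ (insert k B).erase j, twoBody a (y j) (y i)) * (1 / (z - y j)) +
          (∏ i ∈ (insert k B).erase j, twoBody a (-y j) (y i)) * (1 / (z + y j)))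
        = ∑ j ∈ B, y j *
        (twoBody a (y j) (y k) * (∏ i ∈ B.erase j, twoBody a (y j) (y i)) * (1 / (z - y j)) +
          twoBody a (-y j) (y k) * (∏ i ∈ B.erase j, twoBody a (-y j) (y i)) *
            (1 / (z + y j))) := by
      refine sum_congr rfl fun j hj => ?_
      have hjk : k ≠ j := fun h => hk (h ▸ hj)
      rw [erase_insert_of_ne hjk, prod_insert (by simp [hk]), prod_insert (by simp [hk])]
    rw [prod_insert hk, sum_insert hk, erase_insert hk, hsum,
      ih hyB z (fun i hi => hz i (by simp [hi])), ih hyB (y k) hne,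
      ih hyB (-y k) (by simpa using hne)]
    have key : twoBody a z (y k) * ∑ j ∈ B, y j *
          ((∏ i ∈ B.erase j, twoBody a (y j) (y i)) * (1 / (z - y j)) +
            (∏ i ∈ B.erase j, twoBody a (-y j) (y i)) * (1 / (z + y j)))
        = ∑ j ∈ B, y j *
          (twoBody a (y j) (y k) * (∏ i ∈ B.erase j, twoBody a (y j) (y i)) * (1 / (z - y j)) +
            twoBody a (-y j) (y k) * (∏ i ∈ B.erase j, twoBody a (-y j) (y i)) *
              (1 / (z + y j)))
          - a / 2 * y k * ((∑ j ∈ B, y j *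
              ((∏ i ∈ B.erase j, twoBody a (y j) (y i)) * (1 / (y k - y j)) +
                (∏ i ∈ B.erase j, twoBody a (-y j) (y i)) * (1 / (y k + y j)))) * (1 / (z - y k))
            + (∑ j ∈ B, y j *
              ((∏ i ∈ B.erase j, twoBody a (y j) (y i)) * (1 / (-y k - y j)) +
                (∏ i ∈ B.erase j, twoBody a (-y j) (y i)) * (1 / (-y k + y j))))
              * (1 / (z + y k))) := by
      rw [mul_sum, sum_mul, sum_mul, ← sum_add_distrib, mul_sum, ← sum_sub_distrib]
      refine sum_congr rfl fun j hj => ?_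
      have hzj := hz j (by simp [hj])
      have e1 := twoBody_div_sub (a := a) (u := y j) hzk (hne j hj).symm
        (fun h => hzj (by rw [h]))
      have e2 := twoBody_div_sub (a := a) (u := -y j) hzk (by simpa using (hne j hj).symm)
        (fun h => hzj (by rw [h, neg_sq]))
      simp only [sub_neg_eq_add, mul_inv, div_eq_mul_inv, one_mul] at e1 e2 ⊢
      linear_combination y j * (∏ i ∈ B.erase j, twoBody a (y j) (y i)) * e1 +
        y j * (∏ i ∈ B.erase j, twoBody a (-y j) (y i)) * e2
    have e0 := twoBody_eq_partialFractions (a := a) hzk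
    linear_combination (-(a / 2)) * key + e0

/-- The coefficient of `1 / z` in the expansion of `∏ i ∈ B, twoBody a z (y i)` at infinity, as the
sum of the residues. -/
lemma sum_residues_prod_twoBody (a : ℂ) (y : ι → ℂ) (B : Finset ι)
    (hy : Set.InjOn (fun i => y i ^ 2) B) :
    ∑ j ∈ B, y j * ((∏ i ∈ B.erase j, twoBody a (y j) (y i)) +
        (∏ i ∈ B.erase j, twoBody a (-y j) (y i))) = 2 * ∑ j ∈ B, y j := by
  induction B using Finset.induction_on with
  | empty => simp
  | insert k B hk ih =>
    have hyB : Set.InjOn (fun i => y i ^ 2) B := hy.mono (by simp)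
    have hne : ∀ i ∈ B, y k ^ 2 ≠ y i ^ 2 := fun i hi h =>
      hk (hy (by simp) (by simp [hi]) h ▸ hi)
    have hsum : ∑ j ∈ B, y j *
        ((∏ i ∈ (insert k B).erase j, twoBody a (y j) (y i)) +
          (∏ i ∈ (insert k B).erase j, twoBody a (-y j) (y i)))
        = ∑ j ∈ B, y j *
          ((∏ i ∈ B.erase j, twoBody a (y j) (y i)) + (∏ i ∈ B.erase j, twoBody a (-y j) (y i)))
        + a / 2 * y k * (∑ j ∈ B, y j *
            ((∏ i ∈ B.erase j, twoBody a (y j) (y i)) * (1 / (y k - y j)) +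
              (∏ i ∈ B.erase j, twoBody a (-y j) (y i)) * (1 / (y k + y j)))
          + ∑ j ∈ B, y j *
            ((∏ i ∈ B.erase j, twoBody a (y j) (y i)) * (1 / (-y k - y j)) +
              (∏ i ∈ B.erase j, twoBody a (-y j) (y i)) * (1 / (-y k + y j)))) := by
      rw [← sum_add_distrib, mul_sum, ← sum_add_distrib]
      refine sum_congr rfl fun j hj => ?_
      have hjk : k ≠ j := fun h => hk (h ▸ hj)
      rw [erase_insert_of_ne hjk, prod_insert (by simp [hk]), prod_insert (by simp [hk]),
        twoBody_eq_partialFractions (hne j hj).symm,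
        twoBody_eq_partialFractions (z := -y j) (by simpa using (hne j hj).symm)]
      rw [← neg_sub (y j) (y k), show -y k - y j = -(y j + y k) by ring,
        show -y j - y k = -(y k + y j) by ring, show -y j + y k = -(-y k + y j) by ring]
      simp only [one_div, inv_neg]
      ring
    rw [sum_insert hk, sum_insert hk, erase_insert hk, hsum, ih hyB,
      prod_twoBody_eq_partialFractions a y B hyB (y k) hne,
      prod_twoBody_eq_partialFractions a y B hyB (-y k) (by simpa using hne)]
    ring

end PartialFractions

section Weight

variable {ι : Type*} [DecidableEq ι] (a : ℂ) (x : ι → ℂ)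

lemma insert_sdiff_insert_of_notMem {S A : Finset ι} {k : ι} (hk : k ∉ S) :
    insert k S \ insert k A = S \ A := by
  rw [insert_sdiff_insert, sdiff_insert_of_notMem hk]

lemma weight_insert_insert {S A : Finset ι} {k : ι} (hk : k ∉ S) (hA : A ⊆ S) :
    weight a x (insert k S) (insert k A) =
      weight a x S A * ∏ j ∈ S \ A, twoBody a (x k) (x j) := by
  have hkA : k ∉ A := fun h => hk (hA h)
  rw [weight, weight, insert_sdiff_insert_of_notMem hk, prod_insert hkA]
  ring

lemma weight_insert_of_subset {S A : Finset ι} {k : ι} (hk : k ∉ S) (hA : A ⊆ S) :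
    weight a x (insert k S) A = -(weight a x S A * ∏ i ∈ A, twoBody a (x k) (-x i)) := by
  have hkA : k ∉ A := fun h => hk (hA h)
  have hkS : k ∉ S \ A := fun h => hk (mem_sdiff.mp h).1
  rw [weight, weight, insert_sdiff_of_notMem _ hkA, card_insert_of_notMem hkS]
  simp only [prod_insert hkS, prod_mul_distrib, twoBody_neg_right]
  ring

lemma weightedSum_insert {S : Finset ι} {k : ι} (hk : k ∉ S) (p : Finset ι → ℂ) :
    weightedSum a x (insert k S) p = ∑ A ∈ S.powerset, weight a x S A *
      ((∏ j ∈ S \ A, twoBody a (x k) (x j)) * p (insert k A) -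
        (∏ i ∈ A, twoBody a (x k) (-x i)) * p A) := by
  rw [weightedSum, sum_powerset_insert hk, ← sum_add_distrib]
  refine sum_congr rfl fun A hA => ?_
  rw [weight_insert_insert a x hk (mem_powerset.mp hA),
    weight_insert_of_subset a x hk (mem_powerset.mp hA)]
  ring

lemma sum_powerset_sum_sdiff (S : Finset ι) (φ : Finset ι → ι → ℂ) :
    ∑ A ∈ S.powerset, ∑ j ∈ S \ A, φ A j = ∑ k ∈ S, ∑ A ∈ (S.erase k).powerset, φ A k := by
  refine sum_comm' fun A j => ?_
  simp only [mem_powerset, mem_sdiff, subset_erase]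
  tauto

lemma sum_powerset_sum_mem (S : Finset ι) (φ : Finset ι → ι → ℂ) :
    ∑ A ∈ S.powerset, ∑ i ∈ A, φ A i =
      ∑ k ∈ S, ∑ A ∈ (S.erase k).powerset, φ (insert k A) k := by
  rw [sum_sigma', sum_sigma']
  refine sum_bij' (fun p _ => ⟨p.2, p.1.erase p.2⟩) (fun p _ => ⟨insert p.1 p.2, p.1⟩)
    ?_ ?_ ?_ ?_ ?_
  · rintro ⟨A, i⟩ h
    simp only [mem_sigma, mem_powerset] at h ⊢
    exact ⟨h.1 h.2, erase_subset_erase _ h.1⟩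
  · rintro ⟨k, A⟩ h
    simp only [mem_sigma, mem_powerset, subset_erase] at h ⊢
    exact ⟨insert_subset h.1 h.2.1, mem_insert_self _ _⟩
  · rintro ⟨A, i⟩ h
    simp only [mem_sigma] at h
    simp [insert_erase h.2]
  · rintro ⟨k, A⟩ h
    simp only [mem_sigma, mem_powerset, subset_erase] at h
    simp [erase_insert h.2.2]
  · rintro ⟨A, i⟩ h
    simp only [mem_sigma] at h
    simp [insert_erase h.2]

/-- Reorganisation of residues: those at `x k`, weighted by `s k`, and those at `-x k`, weighted by
`t k`, are expressed through the weights on `S.erase k`. -/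
lemma sum_weight_mul_residues (S : Finset ι) (s t : ι → ℂ) (u v : Finset ι → ℂ) :
    ∑ A ∈ S.powerset, weight a x S A *
      (-(∑ j ∈ S \ A, x j * ((∏ i ∈ (S \ A).erase j, twoBody a (x j) (x i)) * s j +
          (∏ i ∈ (S \ A).erase j, twoBody a (-x j) (x i)) * t j)) * u A -
        (∑ j ∈ A, x j * ((∏ i ∈ A.erase j, twoBody a (x j) (-x i)) * s j +
          (∏ i ∈ A.erase j, twoBody a (-x j) (-x i)) * t j)) * v A) =
    ∑ k ∈ S, x k * ∑ A ∈ (S.erase k).powerset, weight a x (S.erase k) A *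
      ((∏ i ∈ A, twoBody a (x k) (-x i)) * (∏ j ∈ S.erase k \ A, twoBody a (x k) (x j)) *
          (u A - v (insert k A)) * s k +
        ((∏ i ∈ S.erase k, twoBody a (x k) (-x i)) * u A -
          (∏ i ∈ S.erase k, twoBody a (x k) (x i)) * v (insert k A)) * t k) := by
  have h1 : ∀ A ∈ S.powerset, weight a x S A *
      (-(∑ j ∈ S \ A, x j * ((∏ i ∈ (S \ A).erase j, twoBody a (x j) (x i)) * s j +
          (∏ i ∈ (S \ A).erase j, twoBody a (-x j) (x i)) * t j)) * u A -
        (∑ j ∈ A, x j * ((∏ i ∈ A.erase j, twoBody a (x j) (-x i)) * s j +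
          (∏ i ∈ A.erase j, twoBody a (-x j) (-x i)) * t j)) * v A) =
      (∑ j ∈ S \ A, -(weight a x S A * u A * x j *
        ((∏ i ∈ (S \ A).erase j, twoBody a (x j) (x i)) * s j +
          (∏ i ∈ (S \ A).erase j, twoBody a (-x j) (x i)) * t j))) +
      ∑ j ∈ A, -(weight a x S A * v A * x j *
        ((∏ i ∈ A.erase j, twoBody a (x j) (-x i)) * s j +
          (∏ i ∈ A.erase j, twoBody a (-x j) (-x i)) * t j)) := by
    intro A _
    rw [sum_neg_distrib, sum_neg_distrib]
    simp only [mul_assoc, ← mul_sum]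
    ring
  rw [sum_congr rfl h1, sum_add_distrib, sum_powerset_sum_sdiff, sum_powerset_sum_mem,
    ← sum_add_distrib]
  refine sum_congr rfl fun k hk => ?_
  rw [← sum_add_distrib, mul_sum]
  refine sum_congr rfl fun A hA => ?_
  have hA' := mem_powerset.mp hA
  have hkS : k ∉ S.erase k := by simp
  have hkA : k ∉ A := fun h => hkS (hA' h)
  have w1 := weight_insert_insert a x hkS hA'
  have w2 := weight_insert_of_subset a x hkS hA'
  rw [insert_erase hk] at w1 w2
  rw [w1, w2, erase_insert hkA, ← erase_sdiff_comm]
  have p1 := prod_sdiff (f := fun i => twoBody a (x k) (-x i)) hA'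
  have p2 := prod_sdiff (f := fun i => twoBody a (x k) (x i)) hA'
  rw [← p1, ← p2]
  simp only [twoBody_neg_left, neg_neg]
  ring

/-- Partial fraction decomposition, in `z`, of a weighted sum with one additional variable `z`. -/
lemma sum_weight_mul_prod_twoBody {S : Finset ι} (hx : Set.InjOn (fun i => x i ^ 2) S) {z : ℂ}
    (hz : ∀ i ∈ S, z ^ 2 ≠ x i ^ 2) (u v : Finset ι → ℂ) :
    ∑ A ∈ S.powerset, weight a x S A *
      ((∏ j ∈ S \ A, twoBody a z (x j)) * u A - (∏ i ∈ A, twoBody a z (-x i)) * v A) =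
    ∑ A ∈ S.powerset, weight a x S A * (u A - v A) +
    a / 2 * ∑ k ∈ S, x k * ∑ A ∈ (S.erase k).powerset, weight a x (S.erase k) A *
      ((∏ i ∈ A, twoBody a (x k) (-x i)) * (∏ j ∈ S.erase k \ A, twoBody a (x k) (x j)) *
          (u A - v (insert k A)) * (1 / (z - x k)) +
        ((∏ i ∈ S.erase k, twoBody a (x k) (-x i)) * u A -
          (∏ i ∈ S.erase k, twoBody a (x k) (x i)) * v (insert k A)) * (1 / (z + x k))) := by
  rw [← sum_weight_mul_residues a x S (fun k => 1 / (z - x k)) (fun k => 1 / (z + x k)),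
    mul_sum, ← sum_add_distrib]
  refine sum_congr rfl fun A hA => ?_
  have hA' := mem_powerset.mp hA
  rw [prod_twoBody_eq_partialFractions a x (S \ A)
      (hx.mono (by exact_mod_cast sdiff_subset)) z (fun i hi => hz i (mem_sdiff.mp hi).1),
    prod_twoBody_eq_partialFractions a (fun i => -x i) A
      (by simpa using hx.mono (by exact_mod_cast hA')) z (by simpa using fun i hi => hz i (hA' hi))]
  have hs : ∑ j ∈ A, -x j * ((∏ i ∈ A.erase j, twoBody a (-x j) (-x i)) * (1 / (z - -x j)) +
        (∏ i ∈ A.erase j, twoBody a (- -x j) (-x i)) * (1 / (z + -x j))) =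
      -∑ j ∈ A, x j * ((∏ i ∈ A.erase j, twoBody a (x j) (-x i)) * (1 / (z - x j)) +
        (∏ i ∈ A.erase j, twoBody a (-x j) (-x i)) * (1 / (z + x j))) := by
    rw [← sum_neg_distrib]
    refine sum_congr rfl fun j _ => ?_
    rw [neg_neg, sub_neg_eq_add, ← sub_eq_add_neg]
    ring
  rw [hs]
  ring

/-- The `1 / z` coefficient at infinity of `sum_weight_mul_prod_twoBody` with `u = 1`, `v = -1`. -/
lemma weightedSum_signedSum_eq {S : Finset ι} (hx : Set.InjOn (fun i => x i ^ 2) S) :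
    2 * weightedSum a x S (signedSum x S) =
    ∑ k ∈ S, x k * ∑ A ∈ (S.erase k).powerset, weight a x (S.erase k) A *
      (2 * ((∏ i ∈ A, twoBody a (x k) (-x i)) * ∏ j ∈ S.erase k \ A, twoBody a (x k) (x j)) +
        ((∏ i ∈ S.erase k, twoBody a (x k) (-x i)) +
          ∏ i ∈ S.erase k, twoBody a (x k) (x i))) := by
  have h := sum_weight_mul_residues a x S (fun _ => 1) (fun _ => 1) (fun _ => 1) (fun _ => -1)
  convert h using 1
  · rw [weightedSum, mul_sum]
    refine sum_congr rfl fun A hA => ?_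
    have hA' := mem_powerset.mp hA
    have e1 := sum_residues_prod_twoBody a x (S \ A) (hx.mono (by exact_mod_cast sdiff_subset))
    have e2 := sum_residues_prod_twoBody a (fun i => -x i) A
      (by simpa using hx.mono (by exact_mod_cast hA'))
    have hs : ∑ j ∈ A, -x j * ((∏ i ∈ A.erase j, twoBody a (-x j) (-x i)) +
          (∏ i ∈ A.erase j, twoBody a (- -x j) (-x i))) =
        -∑ j ∈ A, x j * ((∏ i ∈ A.erase j, twoBody a (x j) (-x i)) +
          (∏ i ∈ A.erase j, twoBody a (-x j) (-x i))) := by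
      rw [← sum_neg_distrib]
      refine sum_congr rfl fun j _ => ?_
      rw [neg_neg]
      ring
    rw [hs, sum_neg_distrib] at e2
    simp only [mul_one, signedSum]
    rw [e1]
    linear_combination weight a x S A * e2
  · refine sum_congr rfl fun k _ => ?_
    congr 1
    refine sum_congr rfl fun A _ => ?_
    ring

end Weight

section Recursion

variable {ι : Type*} [DecidableEq ι]

lemma signedSum_insert_insert (x : ι → ℂ) {S A : Finset ι} {k : ι} (hk : k ∉ S) (hA : A ⊆ S) :
    signedSum x (insert k S) (insert k A) = x k + signedSum x S A := by
  rw [signedSum, signedSum, insert_sdiff_insert_of_notMem hk, sum_insert fun h => hk (hA h)]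
  ring

lemma signedSum_insert_of_subset (x : ι → ℂ) {S A : Finset ι} {k : ι} (hk : k ∉ S) (hA : A ⊆ S) :
    signedSum x (insert k S) A = -x k + signedSum x S A := by
  rw [signedSum, signedSum, insert_sdiff_of_notMem _ fun h => hk (hA h),
    sum_insert fun h => hk (mem_sdiff.mp h).1]
  ring

lemma signedPow_insert_insert (q : ℂ) {S A : Finset ι} {k : ι} (hk : k ∉ S) (hA : A ⊆ S) :
    signedPow q (insert k S) (insert k A) = q * signedPow q S A := by
  rw [signedPow, signedPow, insert_sdiff_insert_of_notMem hk,
    card_insert_of_notMem fun h => hk (hA h)]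
  ring

lemma signedPow_insert_of_subset (q : ℂ) {S A : Finset ι} {k : ι} (hk : k ∉ S) (hA : A ⊆ S) :
    signedPow q (insert k S) A = q⁻¹ * signedPow q S A := by
  rw [signedPow, signedPow, insert_sdiff_of_notMem _ fun h => hk (hA h),
    card_insert_of_notMem fun h => hk (mem_sdiff.mp h).1]
  ring

variable (a : ℂ) (x : ι → ℂ)

/-- The coefficient with which the sums over `S.erase k` enter the recursions. -/
noncomputable def residueDiff (S : Finset ι) (k : ι) : ℂ :=
  ∏ i ∈ S.erase k, twoBody a (x k) (-x i) - ∏ i ∈ S.erase k, twoBody a (x k) (x i)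

/-- The weighted sum of `signedSum` with one additional variable `z`. -/
noncomputable def extendedSignedSum (S : Finset ι) (z : ℂ) : ℂ :=
  ∑ A ∈ S.powerset, weight a x S A *
    ((∏ j ∈ S \ A, twoBody a z (x j)) * (z + signedSum x S A) -
      (∏ i ∈ A, twoBody a z (-x i)) * (-z + signedSum x S A))

lemma weightedSum_signedSum_insert {S : Finset ι} {k : ι} (hk : k ∉ S) :
    weightedSum a x (insert k S) (signedSum x (insert k S)) = extendedSignedSum a x S (x k) := by
  rw [weightedSum_insert a x hk]
  refine sum_congr rfl fun A hA => ?_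
  rw [signedSum_insert_insert x hk (mem_powerset.mp hA),
    signedSum_insert_of_subset x hk (mem_powerset.mp hA)]

lemma extendedSignedSum_zero (S : Finset ι) : extendedSignedSum a x S 0 = 0 := by
  simp [extendedSignedSum, twoBody]

variable {x}

lemma weightedSum_one_insert {S : Finset ι} (hx : Set.InjOn (fun i => x i ^ 2) S) {k : ι}
    (hk : k ∉ S) (hkS : ∀ i ∈ S, x k ^ 2 ≠ x i ^ 2) :
    weightedSum a x (insert k S) (fun _ => 1) =
      a / 2 * ∑ j ∈ S, x j * (residueDiff a x S j * weightedSum a x (S.erase j) fun _ => 1) *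
        (1 / (x k + x j)) := by
  rw [weightedSum_insert a x hk,
    sum_weight_mul_prod_twoBody a x hx hkS (fun _ => 1) (fun _ => 1)]
  simp only [sub_self, mul_zero, sum_const_zero, zero_add, weightedSum, residueDiff, mul_one,
    zero_mul, ← sum_mul]
  congr 1
  exact sum_congr rfl fun j _ => by ring

lemma weightedSum_signedPow_insert {q : ℂ} (hq : q ≠ 0) {S : Finset ι}
    (hx : Set.InjOn (fun i => x i ^ 2) S) {k : ι}
    (hk : k ∉ S) (hkS : ∀ i ∈ S, x k ^ 2 ≠ x i ^ 2) :
    weightedSum a x (insert k S) (signedPow q (insert k S)) =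
      (q - q⁻¹) * weightedSum a x S (signedPow q S) +
      a / 2 * ∑ j ∈ S, x j *
        (residueDiff a x S j * weightedSum a x (S.erase j) (signedPow q (S.erase j))) *
          (1 / (x k + x j)) := by
  have h := sum_weight_mul_prod_twoBody a x hx hkS (fun A => q * signedPow q S A)
    (fun A => q⁻¹ * signedPow q S A)
  have hl : weightedSum a x (insert k S) (signedPow q (insert k S)) = _ :=
    (weightedSum_insert a x hk _).trans (sum_congr rfl fun A hA => by
      rw [signedPow_insert_insert q hk (mem_powerset.mp hA),
        signedPow_insert_of_subset q hk (mem_powerset.mp hA)])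
  rw [hl, h]
  congr 1
  · rw [weightedSum, mul_sum]
    exact sum_congr rfl fun A _ => by ring
  · congr 1
    refine sum_congr rfl fun j hj => ?_
    rw [weightedSum, mul_assoc (x j)]
    congr 1
    rw [mul_sum, sum_mul]
    refine sum_congr rfl fun A hA => ?_
    have hjS : j ∉ S.erase j := by simp
    have e1 := signedPow_insert_insert q hjS (mem_powerset.mp hA)
    have e2 := signedPow_insert_of_subset q hjS (mem_powerset.mp hA)
    rw [insert_erase hj] at e1 e2
    rw [e1, e2, mul_inv_cancel_left₀ hq, inv_mul_cancel_left₀ hq, residueDiff]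
    ring

lemma extendedSignedSum_eq {S : Finset ι} (hx : Set.InjOn (fun i => x i ^ 2) S)
    (hS : weightedSum a x S (fun _ => 1) = 0) {z : ℂ} (hz : ∀ i ∈ S, z ^ 2 ≠ x i ^ 2) :
    extendedSignedSum a x S z = a * weightedSum a x S (signedSum x S) +
      a / 2 * ∑ j ∈ S, x j *
        (residueDiff a x S j * weightedSum a x (S.erase j) (signedSum x (S.erase j)) -
          2 * x j * (∏ i ∈ S.erase j, twoBody a (x j) (-x i) +
            ∏ i ∈ S.erase j, twoBody a (x j) (x i)) *
              weightedSum a x (S.erase j) fun _ => 1) * (1 / (z + x j)) := by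
  have h := sum_weight_mul_prod_twoBody a x hx hz (fun A => z + signedSum x S A)
    (fun A => -z + signedSum x S A)
  have h0 : ∑ A ∈ S.powerset, weight a x S A * (z + signedSum x S A - (-z + signedSum x S A)) =
      0 := by
    have : 2 * z * weightedSum a x S (fun _ => 1) = 0 := by rw [hS, mul_zero]
    rw [← this, weightedSum, mul_sum]
    exact sum_congr rfl fun A _ => by ring
  have hG := weightedSum_signedSum_eq a x hx
  rw [extendedSignedSum, h, h0, zero_add,
    show a * weightedSum a x S (signedSum x S) =
      a / 2 * (2 * weightedSum a x S (signedSum x S)) by ring, hG, ← mul_add, ← sum_add_distrib]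
  congr 1
  refine sum_congr rfl fun j hj => ?_
  rw [mul_assoc (x j), ← mul_add]
  congr 1
  rw [weightedSum, weightedSum, mul_sum, mul_sum, ← sum_sub_distrib, sum_mul, ← sum_add_distrib]
  refine sum_congr rfl fun A hA => ?_
  have hjS : j ∉ S.erase j := by simp
  have e1 := signedSum_insert_insert x hjS (mem_powerset.mp hA)
  have e2 := signedSum_insert_of_subset x hjS (mem_powerset.mp hA)
  rw [insert_erase hj] at e1 e2
  rw [e1, e2, residueDiff]
  have h1 : z - x j ≠ 0 := fun h0 => hz j hj (by linear_combination (z + x j) * h0)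
  have h2 : z + x j ≠ 0 := fun h0 => hz j hj (by linear_combination (z - x j) * h0)
  field_simp
  ring

/-- The unweighted alternating sum vanishes, and the sum weighted by powers of `q` factorises. -/
theorem weightedSum_one_and_signedPow {q : ℂ} (hq : q ≠ 0) (ha : a = q - q⁻¹) (S : Finset ι)
    (hS : S.Nonempty) (hx : Set.InjOn (fun i => x i ^ 2) S) (h0 : ∀ i ∈ S, x i ≠ 0) :
    weightedSum a x S (fun _ => 1) = 0 ∧
      weightedSum a x S (signedPow q S) =
        a / 2 * (∑ i ∈ S, (x i)⁻¹) * weightedSum a x S (signedSum x S) := by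
  induction S using Finset.strongInduction with
  | H S ih =>
  obtain ⟨k, hkS⟩ := hS
  obtain ⟨T, hk, rfl⟩ : ∃ T, k ∉ T ∧ insert k T = S := ⟨S.erase k, by simp, insert_erase hkS⟩
  have hxT : Set.InjOn (fun i => x i ^ 2) T := hx.mono (by simp)
  have hkT : ∀ i ∈ T, x k ^ 2 ≠ x i ^ 2 := fun i hi h =>
    hk (hx (by simp) (by simp [hi]) h ▸ hi)
  have hk0 : x k ≠ 0 := h0 k (by simp)
  have h0T : ∀ i ∈ T, x i ≠ 0 := fun i hi => h0 i (by simp [hi])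
  have hsub : ∀ j ∈ T, (T.erase j).Nonempty →
      weightedSum a x (T.erase j) (fun _ => 1) = 0 ∧
      weightedSum a x (T.erase j) (signedPow q (T.erase j)) =
        a / 2 * (∑ i ∈ T.erase j, (x i)⁻¹) *
          weightedSum a x (T.erase j) (signedSum x (T.erase j)) := fun j hj hne =>
    ih (T.erase j) ((erase_ssubset hj).trans (ssubset_insert hk)) hne
      (hxT.mono (by exact_mod_cast erase_subset j T)) fun i hi => h0T i (mem_of_mem_erase hi)
  have hZ : weightedSum a x (insert k T) (fun _ => 1) = 0 := by
    rw [weightedSum_one_insert a hxT hk hkT, sum_eq_zero, mul_zero]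
    intro j hj
    rcases (T.erase j).eq_empty_or_nonempty with he | hne
    · simp [residueDiff, he]
    · simp [(hsub j hj hne).1]
  refine ⟨hZ, ?_⟩
  rcases T.eq_empty_or_nonempty with rfl | hT
  · rw [weightedSum_signedPow_insert a hq hxT hk hkT, weightedSum_signedSum_insert a x hk, ← ha]
    simp [extendedSignedSum, weightedSum, weight, signedPow, signedSum]
    field_simp
    ring
  obtain ⟨hZT, hFT⟩ := ih T (ssubset_insert hk) hT hxT h0T
  have hz0 : ∀ i ∈ T, (0 : ℂ) ^ 2 ≠ x i ^ 2 := fun i hi => by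
    simpa using (pow_ne_zero 2 (h0T i hi)).symm
  have hG0 := extendedSignedSum_eq a hxT hZT hz0
  rw [extendedSignedSum_zero] at hG0
  rw [weightedSum_signedPow_insert a hq hxT hk hkT, weightedSum_signedSum_insert a x hk,
    extendedSignedSum_eq a hxT hZT hkT, ← ha, hFT, sum_insert hk]
  have key : ∀ j ∈ T, x j *
        (residueDiff a x T j * weightedSum a x (T.erase j) (signedPow q (T.erase j))) *
          (1 / (x k + x j)) =
      a / 2 * (∑ i ∈ T, (x i)⁻¹) * (x j *
        (residueDiff a x T j * weightedSum a x (T.erase j) (signedSum x (T.erase j)) -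
          2 * x j * (∏ i ∈ T.erase j, twoBody a (x j) (-x i) +
            ∏ i ∈ T.erase j, twoBody a (x j) (x i)) *
              weightedSum a x (T.erase j) fun _ => 1) * (1 / (x k + x j))) +
      a / 2 * (x k)⁻¹ * (x j *
        (residueDiff a x T j * weightedSum a x (T.erase j) (signedSum x (T.erase j)) -
          2 * x j * (∏ i ∈ T.erase j, twoBody a (x j) (-x i) +
            ∏ i ∈ T.erase j, twoBody a (x j) (x i)) *
              weightedSum a x (T.erase j) fun _ => 1) * (1 / (x k + x j))) -
      a / 2 * (x k)⁻¹ * (x j *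
        (residueDiff a x T j * weightedSum a x (T.erase j) (signedSum x (T.erase j)) -
          2 * x j * (∏ i ∈ T.erase j, twoBody a (x j) (-x i) +
            ∏ i ∈ T.erase j, twoBody a (x j) (x i)) *
              weightedSum a x (T.erase j) fun _ => 1) * (1 / (0 + x j))) := by
    intro j hj
    have hj0 := h0T j hj
    have h2 : x k + x j ≠ 0 := fun h => hkT j hj (by linear_combination (x k - x j) * h)
    rw [← add_sum_erase T (fun i => (x i)⁻¹) hj, zero_add]
    rcases (T.erase j).eq_empty_or_nonempty with he | hne
    · simp only [residueDiff, he, prod_empty, sum_empty, sub_self]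
      field_simp
      ring
    · rw [(hsub j hj hne).1, (hsub j hj hne).2]
      field_simp
      ring
  rw [sum_congr rfl key, sum_sub_distrib, sum_add_distrib, ← mul_sum, ← mul_sum, ← mul_sum]
  linear_combination (a / 2 * (x k)⁻¹) * hG0

end Recursion

section Exponential

lemma twoBody_exp (s θ θ' : ℂ) :
    twoBody (2 * Complex.I * s) (Complex.exp θ) (Complex.exp θ') =
      1 - Complex.I * s / Complex.sinh (θ - θ') := by
  have h1 := Complex.exp_ne_zero θ
  have h2 := Complex.exp_ne_zero θ'
  have h : Complex.sinh (θ - θ') = (Complex.exp θ ^ 2 - Complex.exp θ' ^ 2) /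
      (2 * Complex.exp θ * Complex.exp θ') := by
    rw [Complex.sinh, neg_sub, Complex.exp_sub, Complex.exp_sub]
    field_simp
  rw [twoBody, h, div_div_eq_mul_div]
  congr 2
  ring

lemma prod_prod_lt_mul_swap {n : ℕ} (φ : Fin n → Fin n → ℂ) (hφ : ∀ i, φ i i = 1) :
    ∏ i : Fin n, ∏ j : Fin n, (if (i : ℕ) < (j : ℕ) then φ i j * φ j i else 1) =
      ∏ i, ∏ j, φ i j := by
  have h : ∀ i j : Fin n, (if (i : ℕ) < (j : ℕ) then φ i j * φ j i else 1) =
      (if (i : ℕ) < (j : ℕ) then φ i j else 1) * (if (i : ℕ) < (j : ℕ) then φ j i else 1) := by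
    intro i j
    split_ifs <;> simp
  simp only [h, prod_mul_distrib]
  rw [prod_comm (f := fun i j : Fin n => if (i : ℕ) < (j : ℕ) then φ j i else 1)]
  simp only [← prod_mul_distrib]
  refine prod_congr rfl fun i _ => prod_congr rfl fun j _ => ?_
  rcases lt_trichotomy (i : ℕ) (j : ℕ) with hij | hij | hij
  · simp only [if_pos hij, if_neg hij.asymm, mul_one]
  · obtain rfl := Fin.ext hij
    simp [hφ]
  · simp only [if_pos hij, if_neg hij.asymm, one_mul]

/-- The configuration which is `0` on `A` and `1` off `A`. -/
def configOf {n : ℕ} (A : Finset (Fin n)) : Fin n → Fin 2 := fun i => if i ∈ A then 0 else 1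

lemma Kfun_eq_weightedSum (ν : ℝ) {n : ℕ} (p : (Fin n → ℂ) → (Fin n → Fin 2) → ℂ)
    (θ : Fin n → ℂ) :
    Kfun ν p θ = weightedSum (2 * Complex.I * (Real.sin (Real.pi * ν) : ℂ))
      (fun i => Complex.exp (θ i)) univ (fun A => p θ (configOf A)) := by
  rw [Kfun, weightedSum]
  refine sum_nbij' (fun l => univ.filter fun i => l i = 0) configOf ?_ ?_ ?_ ?_ ?_
  · simp
  · simp
  · intro l _
    funext i
    simp only [configOf, mem_filter, mem_univ, true_and]
    split_ifs <;> omega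
  · intro A _
    ext i
    simp [configOf]
  · intro l _
    have hl : configOf (univ.filter fun i => l i = 0) = l := by
      funext i
      simp only [configOf, mem_filter, mem_univ, true_and]
      split_ifs <;> omega
    have hcard : ∑ i, (l i : ℕ) = #(univ \ univ.filter fun i => l i = 0) := by
      rw [← filter_not, card_filter]
      refine sum_congr rfl fun i _ => ?_
      split_ifs <;> omega
    rw [hl, weight, hcard]
    congr 2
    rw [← filter_not, prod_filter]
    have hprod := prod_prod_lt_mul_swap (fun i j => if l i = 0 then (if ¬ l j = 0 then
      twoBody (2 * Complex.I * (Real.sin (Real.pi * ν) : ℂ)) (Complex.exp (θ i))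
        (Complex.exp (θ j)) else 1) else 1) (fun i => by split_ifs <;> rfl)
    have hr : ∀ i : Fin n, (if l i = 0 then ∏ j ∈ univ.filter (fun j => ¬ l j = 0),
        twoBody (2 * Complex.I * (Real.sin (Real.pi * ν) : ℂ)) (Complex.exp (θ i))
          (Complex.exp (θ j)) else 1) = ∏ j, if l i = 0 then (if ¬ l j = 0 then
      twoBody (2 * Complex.I * (Real.sin (Real.pi * ν) : ℂ)) (Complex.exp (θ i))
        (Complex.exp (θ j)) else 1) else 1 := by
      intro i
      by_cases h : l i = 0
      · simp only [h, if_true, prod_filter]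
      · simp [h]
    simp only [hr]
    rw [← hprod]
    refine prod_congr rfl fun i _ => prod_congr rfl fun j _ => if_congr Iff.rfl ?_ rfl
    have hc : ∀ m : Fin 2, m = 0 ∨ m = 1 := by decide
    rcases hc (l i) with hi | hi <;> rcases hc (l j) with hj | hj
    · simp [hi, hj]
    · simp only [hi, hj, twoBody_exp]
      simp
      ring
    · simp only [hi, hj, twoBody_exp]
      rw [← neg_sub (θ i) (θ j), Complex.sinh_neg, div_neg]
      simp
    · simp [hi, hj]

lemma pq_configOf (q : ℂ) {n : ℕ} (θ : Fin n → ℂ) (A : Finset (Fin n)) :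
    pq q θ (configOf A) = signedPow q univ A := by
  rw [pq, signedPow, ← prod_sdiff (subset_univ A), mul_comm]
  congr 1
  · rw [prod_congr rfl (g := fun _ => q), prod_const]
    intro i hi
    simp [configOf, hi]
  · rw [prod_congr rfl (g := fun _ => q⁻¹), prod_const]
    intro i hi
    simp [configOf, (mem_sdiff.mp hi).2]

lemma pPM_one_configOf (ν : ℝ) {n : ℕ} (θ : Fin n → ℂ) (A : Finset (Fin n)) :
    pPM ν 1 θ (configOf A) = (∑ i, (Complex.exp (θ i))⁻¹) *
      (-Complex.I * (Real.cos (Real.pi * ν / 2) : ℂ) * ∑ i, Complex.exp (θ i) +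
        (Real.sin (Real.pi * ν / 2) : ℂ) *
          signedSum (fun i => Complex.exp (θ i)) univ A) := by
  have hI : Complex.exp (-(Real.pi * Complex.I / 2)) = -Complex.I := by
    rw [show -(Real.pi * Complex.I / 2) = -(Real.pi / 2 * Complex.I) by ring, Complex.exp_neg,
      Complex.exp_pi_div_two_mul_I, Complex.inv_I]
  have hexp : ∀ i, Complex.exp (1 * (θ i - (Real.pi : ℂ) * Complex.I / 2 *
      (1 - (-1 : ℂ) ^ (configOf A i : ℕ) * (ν : ℂ)))) = Complex.exp (θ i) * (-Complex.I *
        (Real.cos (Real.pi * ν / 2) : ℂ)) + (if i ∈ A then 1 else -1) * Complex.exp (θ i) *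
          (Real.sin (Real.pi * ν / 2) : ℂ) := by
    intro i
    by_cases hi : i ∈ A
    · have hc : (configOf A i : ℕ) = 0 := by simp [configOf, hi]
      rw [hc, show 1 * (θ i - (Real.pi : ℂ) * Complex.I / 2 * (1 - (-1 : ℂ) ^ 0 * (ν : ℂ))) =
        θ i + -(Real.pi * Complex.I / 2) + (Real.pi * ν / 2 : ℝ) * Complex.I by push_cast; ring,
        Complex.exp_add, Complex.exp_add, hI, Complex.exp_mul_I, ← Complex.ofReal_cos,
        ← Complex.ofReal_sin, if_pos hi]
      linear_combination (-Complex.exp (θ i) * (Real.sin (Real.pi * ν / 2) : ℂ)) * Complex.I_sq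
    · have hc : (configOf A i : ℕ) = 1 := by simp [configOf, hi]
      rw [hc, show 1 * (θ i - (Real.pi : ℂ) * Complex.I / 2 * (1 - (-1 : ℂ) ^ 1 * (ν : ℂ))) =
        θ i + -(Real.pi * Complex.I / 2) + (-(Real.pi * ν / 2) : ℝ) * Complex.I by
          push_cast; ring,
        Complex.exp_add, Complex.exp_add, hI, Complex.exp_mul_I, ← Complex.ofReal_cos,
        ← Complex.ofReal_sin, if_neg hi, Real.cos_neg, Real.sin_neg]
      push_cast
      linear_combination (Complex.exp (θ i) * Complex.sin (Real.pi * ν / 2)) * Complex.I_sq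
  have hsigned : ∑ i, (if i ∈ A then 1 else -1) * Complex.exp (θ i) =
      signedSum (fun i => Complex.exp (θ i)) univ A := by
    rw [signedSum, ← sum_sdiff (subset_univ A), add_comm, sub_eq_add_neg, ← sum_neg_distrib]
    congr 1
    · exact sum_congr rfl fun i hi => by simp [hi]
    · exact sum_congr rfl fun i hi => by simp [(mem_sdiff.mp hi).2]
  simp only [pPM, hexp]
  rw [sum_add_distrib, ← sum_mul, ← sum_mul, hsigned]
  congr 1
  · exact sum_congr rfl fun i _ => by rw [← Complex.exp_neg]; ring_nf
  · ring

end Exponential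

/-- Lemma 2, third identity: for `q = e^{iπν}`,
`K̃_n^{(q)}(θ) = 2i cos(πν/2) K̃_n^{+}(θ)`. -/
theorem Ktilde_special_exponential (ν : ℝ) (n : ℕ) (hn : 1 ≤ n)
    (θ : Fin n → ℂ) (hθ : Admissible θ) :
    Kfun ν (pq (Complex.exp (Complex.I * (Real.pi : ℂ) * (ν : ℂ)))) θ
      = 2 * Complex.I * (Real.cos (Real.pi * ν / 2) : ℂ) * Kfun ν (pPM ν 1) θ := by
  have hx : Set.InjOn (fun i => Complex.exp (θ i) ^ 2) (univ : Finset (Fin n)) := by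
    have aux : ∀ i j : Fin n, i < j → Complex.exp (θ i) ^ 2 ≠ Complex.exp (θ j) ^ 2 := by
      intro i j hij h
      apply hθ i j hij
      have h1 := Complex.exp_ne_zero (θ i)
      have h2 := Complex.exp_ne_zero (θ j)
      rw [Complex.sinh, neg_sub, Complex.exp_sub, Complex.exp_sub]
      field_simp
      linear_combination h
    intro i _ j _ h
    rcases lt_trichotomy i j with hij | hij | hij
    · exact absurd h (aux i j hij)
    · exact hij
    · exact absurd h.symm (aux j i hij)
  have hne : (univ : Finset (Fin n)).Nonempty := ⟨⟨0, hn⟩, mem_univ _⟩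
  have hq : 2 * Complex.I * (Real.sin (Real.pi * ν) : ℂ) =
      Complex.exp (Complex.I * (Real.pi : ℂ) * (ν : ℂ)) -
        (Complex.exp (Complex.I * (Real.pi : ℂ) * (ν : ℂ)))⁻¹ := by
    rw [← Complex.exp_neg, show Complex.I * (Real.pi : ℂ) * (ν : ℂ) =
      (Real.pi * ν) * Complex.I by ring, ← neg_mul, Complex.exp_mul_I, Complex.exp_mul_I,
      Complex.cos_neg, Complex.sin_neg]
    push_cast
    ring
  obtain ⟨hZ, hF⟩ := weightedSum_one_and_signedPow _ (Complex.exp_ne_zero _) hq univ hne hx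
    fun i _ => Complex.exp_ne_zero (θ i)
  have hK : Kfun ν (pPM ν 1) θ = (∑ i, (Complex.exp (θ i))⁻¹) *
      (-Complex.I * (Real.cos (Real.pi * ν / 2) : ℂ) * (∑ i, Complex.exp (θ i)) *
        weightedSum (2 * Complex.I * (Real.sin (Real.pi * ν) : ℂ))
          (fun i => Complex.exp (θ i)) univ (fun _ => 1) +
      (Real.sin (Real.pi * ν / 2) : ℂ) *
        weightedSum (2 * Complex.I * (Real.sin (Real.pi * ν) : ℂ))
          (fun i => Complex.exp (θ i)) univ (signedSum (fun i => Complex.exp (θ i)) univ)) := by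
    rw [Kfun_eq_weightedSum]
    simp only [pPM_one_configOf, weightedSum]
    generalize ∑ i, Complex.exp (θ i) = P
    generalize ∑ i, (Complex.exp (θ i))⁻¹ = Q
    rw [mul_sum, mul_sum, ← sum_add_distrib, mul_sum]
    exact sum_congr rfl fun A _ => by ring
  have hsin : (Real.sin (Real.pi * ν) : ℂ) =
      2 * (Real.sin (Real.pi * ν / 2) : ℂ) * (Real.cos (Real.pi * ν / 2) : ℂ) := by
    rw [show Real.pi * ν = 2 * (Real.pi * ν / 2) by ring, Real.sin_two_mul]
    push_cast
    ring_nf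
  rw [hK, hZ, Kfun_eq_weightedSum]
  simp only [pq_configOf]
  refine hF.trans ?_
  generalize weightedSum (2 * Complex.I * (Real.sin (Real.pi * ν) : ℂ)) _
    (univ : Finset (Fin n)) _ = G
  rw [hsin]
  ring
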